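/- There exists m₀ such that for all m ≥ m₀ and all n ≥ 4, every non-adaptive (m,n,s,3)-scheme in which every query function equals MAJORITY on 3 bits and in which, for each x ∈ [m], the three probed locations i₁(x), i₂(x), i₃(x) are pairwise distinct, satisfies s > (1/6)·m^{1 − 1/(⌊n/2⌋+1)}. -/

import Mathlib

open SimpleGraph in
lemma aux_two_paths {V : Type*} {G : SimpleGraph V} {u v : V} (p q : G.Walk u v)
    (hp : p.IsPath) (hq : q.IsPath) (hne : p ≠ q) :
    ∃ (a : V) (c : G.Walk a a), c.IsCycle ∧ c.length ≤ p.length + q.length := by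
  classical
  let E : Set (Sym2 V) := {e | e ∈ p.edges ++ q.edges}
  have hE : ∀ e ∈ E, e ∈ G.edgeSet := by
    intro e he
    rcases List.mem_append.1 he with h | h
    · exact p.edges_subset_edgeSet h
    · exact q.edges_subset_edgeSet h
  let K : SimpleGraph V := SimpleGraph.fromEdgeSet E
  have hK : K.edgeSet ⊆ E := by
    simp only [K, edgeSet_fromEdgeSet]
    exact Set.sdiff_subset
  have hK' : ∀ e ∈ E, e ∈ K.edgeSet := by
    intro e he
    simp only [K, edgeSet_fromEdgeSet]
    exact ⟨he, G.not_isDiag_of_mem_edgeSet (hE e he)⟩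
  have h1 : ∀ e ∈ p.edges, e ∈ K.edgeSet := fun e he => hK' e (List.mem_append.2 (Or.inl he))
  have h2 : ∀ e ∈ q.edges, e ∈ K.edgeSet := fun e he => hK' e (List.mem_append.2 (Or.inr he))
  have hnot : ¬ K.IsAcyclic := by
    intro hac
    have := (hac.subsingleton_path u v).elim ⟨p.transfer K h1, hp.transfer h1⟩
      ⟨q.transfer K h2, hq.transfer h2⟩
    have h3 : p.transfer K h1 = q.transfer K h2 := congrArg Subtype.val this
    apply hne
    apply Walk.ext_support
    rw [← Walk.support_transfer p h1, h3, Walk.support_transfer]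
  unfold IsAcyclic at hnot
  push Not at hnot
  obtain ⟨a, c, hc⟩ := hnot
  have h4 : ∀ e ∈ c.edges, e ∈ G.edgeSet := fun e he => hE e (hK (c.edges_subset_edgeSet he))
  refine ⟨a, c.transfer G h4, hc.transfer h4, ?_⟩
  rw [Walk.length_transfer, ← Walk.length_edges, ← Walk.length_edges, ← Walk.length_edges,
    ← List.length_append]
  have hsub : c.edges ⊆ p.edges ++ q.edges := fun e he => hK (c.edges_subset_edgeSet he)
  exact (hc.edges_nodup.subperm hsub).length_le

open SimpleGraph in
lemma aux_concat {V : Type*} {G : SimpleGraph V} {N : ℕ}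
    (hG : ∀ (a : V) (c : G.Walk a a), c.IsCycle → N < c.length)
    {u v w : V} (p : G.Walk u v) (hp : p.IsPath) (h : G.Adj v w) (hw : w ≠ p.penultimate)
    (hN : p.length + 1 ≤ N) : (p.concat h).IsPath := by
  classical
  refine hp.concat ?_ h
  intro hmem
  have hd := hp.dropUntil hmem
  have h1 : (Walk.cons h.symm Walk.nil : G.Walk w v).IsPath := by
    simp [h.ne.symm]
  have hne : p.dropUntil w hmem ≠ Walk.cons h.symm Walk.nil := by
    intro heq
    apply hw
    have h3 := p.take_spec hmem
    rw [heq, ← Walk.concat_eq_append] at h3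
    rw [← h3, Walk.penultimate_concat]
  obtain ⟨a, c, hc, hl⟩ := aux_two_paths _ _ hd h1 hne
  have := hG a c hc
  have h5 := p.length_dropUntil_le_length hmem
  simp at hl
  omega

/-- endpoints of paths of length exactly `j` -/
noncomputable def auxW {V : Type*} [Fintype V] (G : SimpleGraph V) (a : V) (j : ℕ) : Finset V :=
  open Classical in Finset.univ.filter (fun b => ∃ p : G.Walk a b, p.IsPath ∧ p.length = j)

open SimpleGraph in
lemma aux_grow {V : Type*} [Fintype V] {G : SimpleGraph V} {N : ℕ}
    (hG : ∀ (a : V) (c : G.Walk a a), c.IsCycle → N < c.length)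
    (a : V) (j d : ℕ) (hj : 2 * (j + 1) ≤ N)
    (hd : ∀ b ∈ auxW G a j, ∃ D : Finset V, d + 1 ≤ D.card ∧ ∀ c ∈ D, G.Adj b c) :
    d * (auxW G a j).card ≤ (auxW G a (j+1)).card := by
  classical
  have hP : ∀ b : V, ∃ D : Finset V, b ∈ auxW G a j → d ≤ D.card ∧
      ∃ p : G.Walk a b, p.IsPath ∧ p.length = j ∧ ∀ c ∈ D, G.Adj b c ∧ c ≠ p.penultimate := by
    intro b
    by_cases hb : b ∈ auxW G a j
    · obtain ⟨D, hD, hD2⟩ := hd b hb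
      obtain ⟨p, hp, hl⟩ := (Finset.mem_filter.1 hb).2
      refine ⟨D.erase p.penultimate, fun _ => ⟨?_, p, hp, hl, ?_⟩⟩
      · have := Finset.pred_card_le_card_erase (s := D) (a := p.penultimate)
        omega
      · intro c hc
        rw [Finset.mem_erase] at hc
        exact ⟨hD2 c hc.2, hc.1⟩
    · exact ⟨∅, fun h => absurd h hb⟩
  choose D hD using hP
  have hdisj : ((auxW G a j : Finset V) : Set V).PairwiseDisjoint D := by
    intro b hb b' hb' hne
    rw [Function.onFun, Finset.disjoint_left]
    intro c hc hc'
    obtain ⟨-, p, hp, hl, hpc⟩ := hD b hb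
    obtain ⟨-, p', hp', hl', hpc'⟩ := hD b' hb'
    obtain ⟨h1, h2⟩ := hpc c hc
    obtain ⟨h1', h2'⟩ := hpc' c hc'
    have q := aux_concat hG p hp h1 h2 (by omega)
    have q' := aux_concat hG p' hp' h1' h2' (by omega)
    apply hne
    by_cases heq : p.concat h1 = p'.concat h1'
    · have := congrArg Walk.penultimate heq
      simpa using this
    · exfalso
      obtain ⟨x, k, hk, hkl⟩ := aux_two_paths _ _ q q' heq
      have := hG x k hk
      simp at hkl
      omega
  have hsub : (auxW G a j).biUnion D ⊆ auxW G a (j+1) := by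
    intro c hc
    obtain ⟨b, hb, hc⟩ := Finset.mem_biUnion.1 hc
    obtain ⟨-, p, hp, hl, hpc⟩ := hD b hb
    obtain ⟨h1, h2⟩ := hpc c hc
    refine Finset.mem_filter.2 ⟨Finset.mem_univ _, p.concat h1,
      aux_concat hG p hp h1 h2 (by omega), by simp [hl]⟩
  calc d * (auxW G a j).card = ∑ b ∈ auxW G a j, d := by simp [mul_comm]
    _ ≤ ∑ b ∈ auxW G a j, (D b).card := Finset.sum_le_sum (fun b hb => (hD b hb).1)
    _ = ((auxW G a j).biUnion D).card := (Finset.card_biUnion hdisj).symm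
    _ ≤ _ := Finset.card_le_card hsub

open SimpleGraph in
lemma aux_mem_succ {V : Type*} [Fintype V] {G : SimpleGraph V} (a : V) (j : ℕ) (c : V)
    (hc : c ∈ auxW G a (j+1)) : ∃ b ∈ auxW G a j, G.Adj b c := by
  classical
  obtain ⟨p, hp, hl⟩ := (Finset.mem_filter.1 hc).2
  have hn : ¬ p.Nil := by
    rw [Walk.not_nil_iff_lt_length]; omega
  refine ⟨p.penultimate, Finset.mem_filter.2 ⟨Finset.mem_univ _, p.dropLast, hp.dropLast, ?_⟩,
    p.adj_penultimate hn⟩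
  have := Walk.length_dropLast_add_one hn
  omega

/-- incidence graph of the triples in `H` -/
def auxI {V X : Type*} (inc : X → V → Prop) (H : Finset X) : SimpleGraph (V ⊕ X) where
  Adj a b := (∃ v x, a = Sum.inl v ∧ b = Sum.inr x ∧ x ∈ H ∧ inc x v) ∨
    (∃ v x, b = Sum.inl v ∧ a = Sum.inr x ∧ x ∈ H ∧ inc x v)
  symm := ⟨fun a b h => h.symm⟩
  loopless := ⟨by
    rintro a (⟨v, x, h1, h2, -⟩ | ⟨v, x, h1, h2, -⟩) <;> · rw [h1] at h2; cases h2⟩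

lemma auxI_lr {V X : Type*} (inc : X → V → Prop) (H : Finset X) (v : V) (x : X) :
    (auxI inc H).Adj (Sum.inl v) (Sum.inr x) ↔ x ∈ H ∧ inc x v := by
  simp [auxI]

lemma auxI_l {V X : Type*} (inc : X → V → Prop) (H : Finset X) (v : V) (b : V ⊕ X)
    (h : (auxI inc H).Adj (Sum.inl v) b) : ∃ x, b = Sum.inr x ∧ x ∈ H ∧ inc x v := by
  rcases b with b | b
  · simp [auxI] at h
  · exact ⟨b, rfl, (auxI_lr inc H v b).1 h⟩

lemma auxI_r {V X : Type*} (inc : X → V → Prop) (H : Finset X) (x : X) (b : V ⊕ X)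
    (h : (auxI inc H).Adj (Sum.inr x) b) : ∃ v, b = Sum.inl v ∧ x ∈ H ∧ inc x v := by
  rcases b with b | b
  · exact ⟨b, rfl, (auxI_lr inc H b x).1 h.symm⟩
  · simp [auxI] at h

lemma auxI_mono {V X : Type*} (inc : X → V → Prop) {H H' : Finset X} (h : H ⊆ H') :
    auxI inc H ≤ auxI inc H' := by
  rintro a b (⟨v, x, h1, h2, h3, h4⟩ | ⟨v, x, h1, h2, h3, h4⟩)
  · exact Or.inl ⟨v, x, h1, h2, h h3, h4⟩
  · exact Or.inr ⟨v, x, h1, h2, h h3, h4⟩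

open Classical in
lemma aux_prune {V X : Type*} [Fintype V] (inc : X → V → Prop) (r : ℕ) :
    ∀ (N : ℕ) (H : Finset X),
      (Finset.univ.filter (fun v : V => ∃ x ∈ H, inc x v)).card ≤ N →
      r * (Finset.univ.filter (fun v : V => ∃ x ∈ H, inc x v)).card < H.card →
      ∃ H' ⊆ H, H'.Nonempty ∧ ∀ v, ∀ x ∈ H', inc x v →
        r + 1 ≤ (H'.filter (fun y => inc y v)).card := by
  intro N
  induction N with
  | zero =>
    intro H h0 hH
    have hne : H.Nonempty := Finset.card_pos.1 (by omega)
    refine ⟨H, subset_rfl, hne, ?_⟩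
    intro v x hx hxv
    exfalso
    have h1 := Finset.card_eq_zero.1 (Nat.le_zero.1 h0)
    have : v ∈ (∅ : Finset V) := by
      rw [← h1]
      exact Finset.mem_filter.2 ⟨Finset.mem_univ _, x, hx, hxv⟩
    simp at this
  | succ N ih =>
    intro H h0 hH
    by_cases hgood : ∀ v, ∀ x ∈ H, inc x v → r + 1 ≤ (H.filter (fun y => inc y v)).card
    · exact ⟨H, subset_rfl, Finset.card_pos.1 (by omega), hgood⟩
    · push Not at hgood
      obtain ⟨v, x, hx, hxv, hlt⟩ := hgood
      set A := Finset.univ.filter (fun v : V => ∃ x ∈ H, inc x v) with hA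
      set B := Finset.univ.filter
        (fun u : V => ∃ x ∈ H.filter (fun y => ¬ inc y v), inc x u) with hB
      have hvA : v ∈ A := Finset.mem_filter.2 ⟨Finset.mem_univ _, x, hx, hxv⟩
      have hBA : B ⊆ A.erase v := by
        intro u hu
        obtain ⟨-, y, hy, hyu⟩ := Finset.mem_filter.1 hu
        obtain ⟨hyH, hyv⟩ := Finset.mem_filter.1 hy
        refine Finset.mem_erase.2 ⟨?_, Finset.mem_filter.2 ⟨Finset.mem_univ _, y, hyH, hyu⟩⟩
        rintro rfl
        exact hyv hyu
      have h1 := Finset.card_le_card hBA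
      rw [Finset.card_erase_of_mem hvA] at h1
      have h2 : 0 < A.card := Finset.card_pos.2 ⟨v, hvA⟩
      have h3 := Finset.card_filter_add_card_filter_not (s := H) (fun y => inc y v)
      have h4 : r * B.card + r ≤ r * A.card := by
        rw [← Nat.mul_succ]
        exact Nat.mul_le_mul_left _ (by omega)
      obtain ⟨H', hs, hn, hd⟩ := ih (H.filter (fun y => ¬ inc y v))
        (by have h5 : B.card ≤ N := by omega
            convert h5)
        (by have h5 : r * B.card < (H.filter (fun y => ¬ inc y v)).card := by omega
            convert h5)
      exact ⟨H', hs.trans (Finset.filter_subset _ _), hn, hd⟩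

open SimpleGraph in
lemma aux_moore {V X : Type*} [Fintype V] [Fintype X] (inc : X → V → Prop)
    (elt : ∀ x, ∃ v, inc x v) (h3 : ∀ x a b, ∃ c, inc x c ∧ c ≠ a ∧ c ≠ b)
    (r k : ℕ) (hr : Fintype.card V < r ^ k) (H : Finset X) (hH : r * Fintype.card V < H.card) :
    ∃ (a : V ⊕ X) (c : (auxI inc H).Walk a a), c.IsCycle ∧ c.length ≤ 4 * k := by
  classical
  have hcard : (Finset.univ.filter (fun v : V => ∃ x ∈ H, inc x v)).card ≤ Fintype.card V :=
    Finset.card_le_univ _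
  obtain ⟨H', hs, ⟨x0, hx0⟩, hdeg⟩ := aux_prune inc r _ H le_rfl
    (lt_of_le_of_lt (Nat.mul_le_mul_left _ hcard) hH)
  suffices h : ∃ (a : V ⊕ X) (c : (auxI inc H').Walk a a), c.IsCycle ∧ c.length ≤ 4 * k by
    obtain ⟨a, c, hc, hl⟩ := h
    exact ⟨a, c.mapLe (auxI_mono inc hs), hc.mapLe _, by simpa using hl⟩
  by_contra hcon
  push Not at hcon
  obtain ⟨v0, hv0⟩ := elt x0
  have key : ∀ i, i ≤ k → r ^ i ≤ (auxW (auxI inc H') (Sum.inl v0) (2 * i)).card ∧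
      ∀ b ∈ auxW (auxI inc H') (Sum.inl v0) (2 * i), ∃ v x, b = Sum.inl v ∧ x ∈ H' ∧ inc x v := by
    intro i
    induction i with
    | zero =>
      intro _
      constructor
      · simp only [pow_zero, mul_zero]
        apply Finset.card_pos.2
        exact ⟨Sum.inl v0, Finset.mem_filter.2 ⟨Finset.mem_univ _, Walk.nil, by simp⟩⟩
      · intro b hb
        obtain ⟨p, hp, hl⟩ := (Finset.mem_filter.1 hb).2
        have := Walk.eq_of_length_eq_zero hl
        exact ⟨v0, x0, this.symm, hx0, hv0⟩
    | succ i ih =>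
      intro hi
      obtain ⟨ih1, ih2⟩ := ih (by omega)
      have g1 : r * (auxW (auxI inc H') (Sum.inl v0) (2 * i)).card ≤
          (auxW (auxI inc H') (Sum.inl v0) (2 * i + 1)).card := by
        apply aux_grow hcon _ _ _ (by omega)
        intro b hb
        obtain ⟨v, x, rfl, hx, hxv⟩ := ih2 b hb
        refine ⟨(H'.filter (fun y => inc y v)).map ⟨Sum.inr, Sum.inr_injective⟩, ?_, ?_⟩
        · rw [Finset.card_map]
          exact hdeg v x hx hxv
        · intro c hc
          obtain ⟨y, hy, rfl⟩ := Finset.mem_map.1 hc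
          exact (auxI_lr inc H' v y).2 (Finset.mem_filter.1 hy)
      have odd : ∀ b ∈ auxW (auxI inc H') (Sum.inl v0) (2 * i + 1),
          ∃ x, b = Sum.inr x ∧ x ∈ H' := by
        intro b hb
        obtain ⟨c, hc, hadj⟩ := aux_mem_succ _ _ _ hb
        obtain ⟨v, x, rfl, hx, hxv⟩ := ih2 c hc
        obtain ⟨y, rfl, hy, -⟩ := auxI_l _ _ _ _ hadj
        exact ⟨y, rfl, hy⟩
      have g2 : 1 * (auxW (auxI inc H') (Sum.inl v0) (2 * i + 1)).card ≤
          (auxW (auxI inc H') (Sum.inl v0) (2 * i + 1 + 1)).card := by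
        apply aux_grow hcon _ _ _ (by omega)
        intro b hb
        obtain ⟨x, rfl, hx⟩ := odd b hb
        obtain ⟨c, hc⟩ := elt x
        obtain ⟨d, hd, hdc, -⟩ := h3 x c c
        refine ⟨{Sum.inl c, Sum.inl d}, ?_, ?_⟩
        · rw [Finset.card_pair]
          intro h
          exact hdc (Sum.inl_injective h).symm
        · intro z hz
          rw [Finset.mem_insert, Finset.mem_singleton] at hz
          rcases hz with rfl | rfl
          · exact ((auxI_lr inc H' _ x).2 ⟨hx, hc⟩).symm
          · exact ((auxI_lr inc H' _ x).2 ⟨hx, hd⟩).symm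
      refine ⟨?_, ?_⟩
      · rw [show 2 * (i + 1) = 2 * i + 1 + 1 by ring]
        calc r ^ (i+1) = r * r ^ i := by ring
          _ ≤ r * (auxW (auxI inc H') (Sum.inl v0) (2 * i)).card := Nat.mul_le_mul_left _ ih1
          _ ≤ _ := by omega
      · intro b hb
        rw [show 2 * (i + 1) = 2 * i + 1 + 1 by ring] at hb
        obtain ⟨c, hc, hadj⟩ := aux_mem_succ _ _ _ hb
        obtain ⟨x, rfl, hx⟩ := odd c hc
        obtain ⟨v, rfl, hx, hv⟩ := auxI_r _ _ _ _ hadj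
        exact ⟨v, x, rfl, hx, hv⟩
  obtain ⟨k1, k2⟩ := key k le_rfl
  have : auxW (auxI inc H') (Sum.inl v0) (2 * k) ⊆
      (Finset.univ : Finset V).map ⟨Sum.inl, Sum.inl_injective⟩ := by
    intro b hb
    obtain ⟨v, x, rfl, -⟩ := k2 b hb
    simp
  have := Finset.card_le_card this
  rw [Finset.card_map, Finset.card_univ] at this
  omega

open SimpleGraph in
lemma aux_seq {V X : Type*} (inc : X → V → Prop) (H : Finset X) (v0 : V)
    (p : (auxI inc H).Walk (Sum.inl v0) (Sum.inl v0)) (hp : p.IsCycle) :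
    ∃ (L : ℕ) (v : ℕ → V) (e : ℕ → X), 2 ≤ L ∧ p.length = 2 * L ∧
      (∀ i, e i ∈ H ∧ inc (e i) (v i) ∧ inc (e i) (v (i+1))) ∧
      (∀ i j, v i = v j ↔ i % L = j % L) ∧ (∀ i j, e i = e j ↔ i % L = j % L) := by
  have hlen := hp.three_le_length
  have par : ∀ i, (2 * i ≤ p.length → ∃ v, p.getVert (2 * i) = Sum.inl v) := by
    intro i
    induction i with
    | zero => intro _; exact ⟨v0, by simp⟩
    | succ i ih =>
      intro hi
      obtain ⟨v, hv⟩ := ih (by omega)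
      have h1 := p.adj_getVert_succ (i := 2 * i) (by omega)
      rw [hv] at h1
      obtain ⟨x, hx, -⟩ := auxI_l _ _ _ _ h1
      have h2 := p.adj_getVert_succ (i := 2 * i + 1) (by omega)
      rw [hx] at h2
      obtain ⟨w, hw, -⟩ := auxI_r _ _ _ _ h2
      exact ⟨w, hw⟩
  have par' : ∀ i, (2 * i + 1 ≤ p.length → ∃ x, p.getVert (2 * i + 1) = Sum.inr x) := by
    intro i hi
    obtain ⟨v, hv⟩ := par i (by omega)
    have h1 := p.adj_getVert_succ (i := 2 * i) (by omega)
    rw [hv] at h1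
    obtain ⟨x, hx, -⟩ := auxI_l _ _ _ _ h1
    exact ⟨x, hx⟩
  have heven : p.length = 2 * (p.length / 2) := by
    by_contra hne
    obtain ⟨x, hx⟩ := par' (p.length / 2) (by omega)
    rw [show 2 * (p.length / 2) + 1 = p.length by omega, p.getVert_length] at hx
    cases hx
  set L := p.length / 2 with hL
  have hL2 : 2 ≤ L := by omega
  have hV : ∀ i, ∃ v, p.getVert (2 * (i % L)) = Sum.inl v := fun i =>
    par _ (by have := Nat.mod_lt i (show 0 < L by omega); omega)
  have hX : ∀ i, ∃ x, p.getVert (2 * (i % L) + 1) = Sum.inr x := fun i =>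
    par' _ (by have := Nat.mod_lt i (show 0 < L by omega); omega)
  choose v hv using hV
  choose e he using hX
  have hinj := hp.getVert_injOn'
  refine ⟨L, v, e, hL2, heven, ?_, ?_, ?_⟩
  · intro i
    have hi := Nat.mod_lt i (show 0 < L by omega)
    have h1 := p.adj_getVert_succ (i := 2 * (i % L)) (by omega)
    rw [hv, he] at h1
    have h2 := p.adj_getVert_succ (i := 2 * (i % L) + 1) (by omega)
    have h3 : p.getVert (2 * (i % L) + 1 + 1) = Sum.inl (v (i + 1)) := by
      rw [← hv (i+1)]
      by_cases hlast : i % L + 1 = L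
      · have : (i + 1) % L = 0 := by
          rw [Nat.add_mod, Nat.mod_eq_of_lt (show 1 < L by omega), hlast, Nat.mod_self]
        rw [this, show 2 * (i % L) + 1 + 1 = p.length by omega, p.getVert_length]
        simp
      · have : (i + 1) % L = i % L + 1 := by
          rw [Nat.add_mod, Nat.mod_eq_of_lt (show 1 < L by omega), Nat.mod_eq_of_lt (by omega)]
        rw [this]
        congr 1
    rw [h3, he] at h2
    rw [auxI_lr] at h1
    have h4 := (auxI_lr _ _ _ _).1 h2.symm
    exact ⟨h1.1, h1.2, h4.2⟩
  · intro i j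
    have hi := Nat.mod_lt i (show 0 < L by omega)
    have hj := Nat.mod_lt j (show 0 < L by omega)
    constructor
    · intro h
      have h1 : p.getVert (2 * (i % L)) = p.getVert (2 * (j % L)) := by rw [hv, hv, h]
      have := hinj (by simp only [Set.mem_ofPred_eq]; omega)
        (by simp only [Set.mem_ofPred_eq]; omega) h1
      omega
    · intro h
      apply Sum.inl_injective (β := X)
      rw [← hv, ← hv, h]
  · intro i j
    have hi := Nat.mod_lt i (show 0 < L by omega)
    have hj := Nat.mod_lt j (show 0 < L by omega)
    constructor
    · intro h
      have h1 : p.getVert (2 * (i % L) + 1) = p.getVert (2 * (j % L) + 1) := by rw [he, he, h]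
      have := hinj (by simp only [Set.mem_ofPred_eq]; omega)
        (by simp only [Set.mem_ofPred_eq]; omega) h1
      omega
    · intro h
      apply Sum.inr_injective (α := V)
      rw [← he, ← he, h]

open SimpleGraph in
/-- a path of length `2 d` along the cyclic sequence, starting at a triple -/
lemma aux_arc {V X : Type*} (inc : X → V → Prop) (H : Finset X) (L : ℕ) (v : ℕ → V) (e : ℕ → X)
    (hinc : ∀ i, e i ∈ H ∧ inc (e i) (v i) ∧ inc (e i) (v (i+1)))
    (hv : ∀ i j, v i = v j ↔ i % L = j % L) (he : ∀ i j, e i = e j ↔ i % L = j % L)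
    (d : ℕ) : ∀ i, d < L →
    ∃ p : (auxI inc H).Walk (Sum.inr (e i)) (Sum.inr (e (i + d))), p.IsPath ∧ p.length = 2 * d ∧
      (∀ z ∈ p.support, (∃ t, t ≤ d ∧ z = Sum.inr (e (i + t))) ∨
        (∃ t, 1 ≤ t ∧ t ≤ d ∧ z = Sum.inl (v (i + t)))) ∧
      (1 ≤ d → p.getVert 1 = Sum.inl (v (i+1))) := by
  induction d with
  | zero =>
    intro i _
    refine ⟨Walk.nil, by simp, by simp, ?_, by simp⟩
    intro z hz
    left
    exact ⟨0, le_rfl, by simpa using hz⟩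
  | succ d ih =>
    intro i hd
    have aux : ∀ a b c : ℕ, a < b → b < a + L → (a % L = b % L) → False := by
      intro a b _ h1 h2 h3
      have h4 := (Nat.modEq_iff_dvd' h1.le).1 h3
      have := Nat.le_of_dvd (by omega) h4
      omega
    obtain ⟨p, hp, hl, hs, -⟩ := ih (i+1) (by omega)
    have hadj1 : (auxI inc H).Adj (Sum.inr (e i)) (Sum.inl (v (i+1))) :=
      ((auxI_lr _ _ _ _).2 ⟨(hinc i).1, (hinc i).2.2⟩).symm
    have hadj2 : (auxI inc H).Adj (Sum.inl (v (i+1))) (Sum.inr (e (i+1))) :=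
      (auxI_lr _ _ _ _).2 ⟨(hinc (i+1)).1, (hinc (i+1)).2.1⟩
    have heq : i + 1 + d = i + (d + 1) := by ring
    have main : ∃ p : (auxI inc H).Walk (Sum.inr (e i)) (Sum.inr (e (i + 1 + d))),
      p.IsPath ∧ p.length = 2 * (d + 1) ∧
      (∀ z ∈ p.support, (∃ t, t ≤ d + 1 ∧ z = Sum.inr (e (i + t))) ∨
        (∃ t, 1 ≤ t ∧ t ≤ d + 1 ∧ z = Sum.inl (v (i + t)))) ∧
      (1 ≤ d + 1 → p.getVert 1 = Sum.inl (v (i+1))) := by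
      refine ⟨Walk.cons hadj1 (Walk.cons hadj2 p), ?_, ?_, ?_, ?_⟩
      · rw [Walk.cons_isPath_iff, Walk.cons_isPath_iff]
        refine ⟨⟨hp, ?_⟩, ?_⟩
        · intro hm
          rcases hs _ hm with ⟨t, ht, h⟩ | ⟨t, ht, ht', h⟩
          · cases h
          · have := (hv _ _).1 (Sum.inl_injective h)
            exact aux (i+1) (i+1+t) 0 (by omega) (by omega) this
        · rw [Walk.support_cons, List.mem_cons]
          rintro (h | hm)
          · cases h
          rcases hs _ hm with ⟨t, ht, h⟩ | ⟨t, ht, ht', h⟩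
          · have := (he _ _).1 (Sum.inr_injective h)
            exact aux i (i+1+t) 0 (by omega) (by omega) this
          · cases h
      · simp [hl]; ring
      · intro z hz
        rw [Walk.support_cons, Walk.support_cons, List.mem_cons, List.mem_cons] at hz
        rcases hz with rfl | rfl | hz
        · exact Or.inl ⟨0, by omega, rfl⟩
        · exact Or.inr ⟨1, by omega, by omega, rfl⟩
        · rcases hs _ hz with ⟨t, ht, h⟩ | ⟨t, ht, ht', h⟩
          · exact Or.inl ⟨t + 1, by omega, by rw [h]; congr 2; ring⟩
          · exact Or.inr ⟨t + 1, by omega, by omega, by rw [h]; congr 2; ring⟩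
      · intro _
        simp
    rwa [heq] at main

/-- alternating closed walk of odd length forces the bit at its base point -/
lemma aux_force {V X : Type*} (inc : X → V → Prop) (Maj : (V → Bool) → X → Prop)
    (hT : ∀ σ x a b, Maj σ x → inc x a → inc x b → a ≠ b → σ a = false → σ b = true)
    (hF : ∀ σ x a b, ¬ Maj σ x → inc x a → inc x b → a ≠ b → σ a = true → σ b = false)
    (N : ℕ) (hN : N % 2 = 1) (u : ℕ → V) (x : ℕ → X) (huN : u N = u 0)
    (hinc : ∀ t < N, inc (x t) (u t) ∧ inc (x t) (u (t+1)) ∧ u t ≠ u (t+1))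
    (σ : V → Bool) (β : Bool)
    (h1 : ∀ t < N, t % 2 = 0 → (Maj σ (x t) ↔ β = true))
    (h2 : ∀ t < N, t % 2 = 1 → (Maj σ (x t) ↔ β = false)) : σ (u 0) = β := by
  by_contra hne
  have key : ∀ t, t ≤ N → ((t % 2 = 0 → σ (u t) = !β) ∧ (t % 2 = 1 → σ (u t) = β)) := by
    intro t
    induction t with
    | zero =>
      intro _
      refine ⟨fun _ => ?_, fun h => by omega⟩
      revert hne
      cases σ (u 0) <;> cases β <;> simp
    | succ t ih =>
      intro ht
      obtain ⟨i1, i2⟩ := ih (by omega)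
      obtain ⟨a1, a2, a3⟩ := hinc t (by omega)
      have b1 := h1 t (by omega)
      have b2 := h2 t (by omega)
      have c1 := fun h => hT σ (x t) _ _ h a1 a2 a3
      have c2 := fun h => hF σ (x t) _ _ h a1 a2 a3
      constructor
      · intro hpar
        have e1 := i2 (by omega)
        have e2 := b2 (by omega)
        cases β
        · exact c1 (e2.2 rfl) e1
        · exact c2 (by rw [e2]; simp) e1
      · intro hpar
        have e1 := i1 (by omega)
        have e2 := b1 (by omega)
        cases β
        · exact c2 (by rw [e2]; simp) e1
        · exact c1 (e2.2 rfl) e1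
  have := (key N le_rfl).2 hN
  rw [huN] at this
  exact hne this

/-- with few positive triples in `C` one can force the bit at `w` to be `β` -/
def auxF {V X : Type*} (Maj : (V → Bool) → X → Prop) (k : ℕ) (C : Finset X) (w : V)
    (β : Bool) : Prop :=
  ∃ T ⊆ C, T.card ≤ k ∧ ∀ σ : V → Bool, (∀ x ∈ C, Maj σ x ↔ x ∈ T) → σ w = β

lemma aux_modinj {L j t t' : ℕ} (ht : t < L) (ht' : t' < L) (h : (j + t) % L = (j + t') % L) :
    t = t' := by
  have h1 : t % L = t' % L := Nat.ModEq.add_left_cancel' j h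
  rwa [Nat.mod_eq_of_lt ht, Nat.mod_eq_of_lt ht'] at h1

open Classical in
lemma aux_T {X : Type*} (L k : ℕ) (e : ℕ → X) (hL : 2 ≤ L) (hk : L ≤ 2 * k)
    (he : ∀ i j, e i = e j ↔ i % L = j % L) (j : ℕ) (β : Bool) :
    ∃ T ⊆ (Finset.range L).image e, T.card ≤ k ∧
      ∀ t < L, (t % 2 = 0 → (e (j + t) ∈ T ↔ β = true)) ∧
        (t % 2 = 1 → (e (j + t) ∈ T ↔ β = false)) := by
  have hmem : ∀ i, e i ∈ (Finset.range L).image e := by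
    intro i
    refine Finset.mem_image.2 ⟨i % L, Finset.mem_range.2 (Nat.mod_lt _ (by omega)), ?_⟩
    rw [he, Nat.mod_mod]
  cases β
  · refine ⟨(Finset.range (L / 2)).image (fun t => e (j + (2 * t + 1))), ?_, ?_, ?_⟩
    · intro x hx
      obtain ⟨t, -, rfl⟩ := Finset.mem_image.1 hx
      exact hmem _
    · refine Finset.card_image_le.trans ?_
      rw [Finset.card_range]; omega
    · intro t ht
      constructor
      · intro hpar
        simp only [Bool.false_eq_true, iff_false]
        intro hx
        obtain ⟨t', ht', h⟩ := Finset.mem_image.1 hx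
        rw [Finset.mem_range] at ht'
        have := aux_modinj (by omega) ht ((he _ _).1 h)
        omega
      · intro hpar
        simp only [iff_true]
        refine Finset.mem_image.2 ⟨t / 2, Finset.mem_range.2 (by omega), ?_⟩
        congr 2; omega
  · refine ⟨(Finset.range ((L + 1) / 2)).image (fun t => e (j + 2 * t)), ?_, ?_, ?_⟩
    · intro x hx
      obtain ⟨t, -, rfl⟩ := Finset.mem_image.1 hx
      exact hmem _
    · refine Finset.card_image_le.trans ?_
      rw [Finset.card_range]; omega
    · intro t ht
      constructor
      · intro hpar
        simp only [iff_true]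
        refine Finset.mem_image.2 ⟨t / 2, Finset.mem_range.2 (by omega), ?_⟩
        congr 2; omega
      · intro hpar
        simp only [Bool.true_eq_false, iff_false]
        intro hx
        obtain ⟨t', ht', h⟩ := Finset.mem_image.1 hx
        rw [Finset.mem_range] at ht'
        have := aux_modinj (by omega) ht ((he _ _).1 h)
        omega

open Classical SimpleGraph in
lemma aux_core {V X : Type*} (inc : X → V → Prop) (Maj : (V → Bool) → X → Prop)
    (hT : ∀ σ x a b, Maj σ x → inc x a → inc x b → a ≠ b → σ a = false → σ b = true)
    (hF : ∀ σ x a b, ¬ Maj σ x → inc x a → inc x b → a ≠ b → σ a = true → σ b = false)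
    (h3 : ∀ x a b, ∃ c, inc x c ∧ c ≠ a ∧ c ≠ b) (k : ℕ)
    (hS : ∀ T : Finset X, T.card ≤ 2 * k → ∃ σ, ∀ x, Maj σ x ↔ x ∈ T)
    (H : Finset X) (L : ℕ) (v : ℕ → V) (e : ℕ → X) (hL : 2 ≤ L) (hk : L ≤ 2 * k)
    (hinc : ∀ i, e i ∈ H ∧ inc (e i) (v i) ∧ inc (e i) (v (i+1)))
    (hv : ∀ i j, v i = v j ↔ i % L = j % L) (he : ∀ i j, e i = e j ↔ i % L = j % L)
    (hmin : ∀ a (c : (auxI inc H).Walk a a), c.IsCycle → 2 * L ≤ c.length) :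
    ∃ Q : Finset V, L ≤ Q.card ∧ ∀ w ∈ Q, ∀ β, auxF Maj k ((Finset.range L).image e) w β := by
  have hmem : ∀ i, e i ∈ (Finset.range L).image e := by
    intro i
    refine Finset.mem_image.2 ⟨i % L, Finset.mem_range.2 (Nat.mod_lt _ (by omega)), ?_⟩
    rw [he, Nat.mod_mod]
  have hvne : ∀ i, v i ≠ v (i+1) := by
    intro i h
    have := aux_modinj (j := i) (t := 0) (t' := 1) (by omega) (by omega) ((hv _ _).1 h)
    omega
  by_cases hpar : L % 2 = 1
  · -- odd cycle
    refine ⟨(Finset.range L).image v, ?_, ?_⟩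
    · rw [Finset.card_image_of_injOn, Finset.card_range]
      intro a ha b hb h
      simp only [Finset.coe_range, Set.mem_Iio] at ha hb
      have := (hv _ _).1 h
      rwa [Nat.mod_eq_of_lt ha, Nat.mod_eq_of_lt hb] at this
    · intro w hw β
      obtain ⟨j, -, rfl⟩ := Finset.mem_image.1 hw
      obtain ⟨T, hTC, hcard, hT'⟩ := aux_T L k e hL hk he j β
      refine ⟨T, hTC, hcard, fun σ hσ => ?_⟩
      refine aux_force inc Maj hT hF L hpar (fun t => v (j + t)) (fun t => e (j + t)) ?_ ?_ σ β ?_ ?_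
      · exact (hv _ _).2 (by simp)
      · intro t _
        exact ⟨(hinc _).2.1, (hinc _).2.2, hvne _⟩
      · intro t ht h
        exact (hσ _ (hmem _)).trans ((hT' t ht).1 h)
      · intro t ht h
        exact (hσ _ (hmem _)).trans ((hT' t ht).2 h)
  · -- even cycle
    choose third hthird using h3
    let w : ℕ → V := fun j => third (e j) (v j) (v (j+1))
    have hw : ∀ j, inc (e j) (w j) ∧ w j ≠ v j ∧ w j ≠ v (j+1) := fun j => hthird _ _ _
    have force : ∀ (j : ℕ) (β : Bool) (T : Finset X),
        (∀ t < L, (t % 2 = 0 → (e (j + t) ∈ T ↔ β = true)) ∧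
        (t % 2 = 1 → (e (j + t) ∈ T ↔ β = false))) →
        ∀ σ, (∀ x ∈ (Finset.range L).image e, Maj σ x ↔ x ∈ T) → σ (w j) = β := by
      intro j β T hT' σ hσ
      have hT'' : ∀ t < L + 1, (t % 2 = 0 → (e (j + t) ∈ T ↔ β = true)) ∧
          (t % 2 = 1 → (e (j + t) ∈ T ↔ β = false)) := by
        intro t ht
        rcases Nat.lt_succ_iff_lt_or_eq.1 ht with h | rfl
        · exact hT' t h
        · refine ⟨fun _ => ?_, fun h => by omega⟩
          have h0 := (hT' 0 (by omega)).1 rfl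
          have : e (j + t) = e (j + 0) := (he _ _).2 (by simp)
          rwa [this]
      have hvL : v (j + L) = v j := (hv _ _).2 (by simp)
      have heL : e (j + L) = e j := (he _ _).2 (by simp)
      have := aux_force inc Maj hT hF (L + 1) (by omega)
        (fun t => if t = 0 ∨ t = L + 1 then w j else v (j + t)) (fun t => e (j + t))
        (by simp) ?_ σ β ?_ ?_
      · simpa using this
      · intro t ht
        rcases Nat.eq_zero_or_pos t with rfl | hpos
        · have hL0 : L ≠ 0 := by omega
          simp only [true_or, if_true, add_zero, zero_add, one_ne_zero, false_or]
          rw [if_neg (by omega)]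
          exact ⟨(hw j).1, (hinc j).2.2, (hw j).2.2⟩
        · by_cases htL : t = L
          · subst htL
            rw [if_neg (by omega), if_pos (by omega), heL, hvL]
            exact ⟨(hinc j).2.1, (hw j).1, (hw j).2.1.symm⟩
          · rw [if_neg (by omega), if_neg (by omega)]
            exact ⟨(hinc _).2.1, (hinc _).2.2, hvne _⟩
      · intro t ht h
        exact (hσ _ (hmem _)).trans ((hT'' t ht).1 h)
      · intro t ht h
        exact (hσ _ (hmem _)).trans ((hT'' t ht).2 h)
    have hwper : ∀ i, w (i + L) = w i := by
      intro i
      have a1 : e (i + L) = e i := (he _ _).2 (by simp)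
      have a2 : v (i + L) = v i := (hv _ _).2 (by simp)
      have a3 : v (i + L + 1) = v (i + 1) := (hv _ _).2 (by
        rw [show i + L + 1 = i + 1 + L by ring]; simp)
      simp only [w, a1, a2, a3]
    have hdist : ∀ i d, 1 ≤ d → 2 * d ≤ L → w i ≠ w (i + d) := by
      intro i d hd1 hd2 heq
      by_cases hL2 : L = 2
      · have hd : d = 1 := by omega
        subst hd
        subst hL2
        obtain ⟨σ, hσ⟩ := hS {e i} (by simp; omega)
        have e1 : ∀ t, e (i + t) = e i ↔ t % 2 = 0 := by
          intro t
          rw [he]; omega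
        have f1 := force i true {e i} (by
          intro t ht
          simp only [Finset.mem_singleton, e1]
          simp) σ (fun x _ => hσ x)
        have f2 := force (i+1) false {e i} (by
          intro t ht
          rw [add_assoc]
          simp only [Finset.mem_singleton, e1]
          constructor
          · intro h; simp; omega
          · intro h; simp; omega) σ (fun x _ => hσ x)
        rw [heq, f2] at f1
        cases f1
      · obtain ⟨p, hp, hl, -, hsec⟩ := aux_arc inc H L v e hinc hv he d i (by omega)
        have g1 : (auxI inc H).Adj (Sum.inr (e i)) (Sum.inl (w i)) :=
          ((auxI_lr _ _ _ _).2 ⟨(hinc i).1, (hw i).1⟩).symm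
        have g2 : (auxI inc H).Adj (Sum.inl (w i)) (Sum.inr (e (i+d))) :=
          (auxI_lr _ _ _ _).2 ⟨(hinc _).1, by rw [heq]; exact (hw _).1⟩
        have hne : e i ≠ e (i + d) := by
          intro h
          have := aux_modinj (j := i) (t := 0) (t' := d) (by omega) (by omega) ((he _ _).1 h)
          omega
        have hq : (Walk.cons g1 (Walk.cons g2 Walk.nil)).IsPath := by
          simp [hne]
        have hpq : p ≠ Walk.cons g1 (Walk.cons g2 Walk.nil) := by
          intro h
          have h1 := hsec hd1
          rw [h] at h1
          simp at h1
          exact (hw i).2.2 h1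
        obtain ⟨a, c, hc, hcl⟩ := aux_two_paths _ _ hp hq hpq
        have := hmin a c hc
        simp [hl] at hcl
        omega
    have hinj : ∀ a b, a < b → b < L → w a ≠ w b := by
      intro a b hab hb
      by_cases hd : 2 * (b - a) ≤ L
      · have := hdist a (b - a) (by omega) hd
        rwa [show a + (b - a) = b by omega] at this
      · have := hdist b (L - (b - a)) (by omega) (by omega)
        rw [show b + (L - (b - a)) = a + L by omega, hwper] at this
        exact this.symm
    refine ⟨(Finset.range L).image w, ?_, ?_⟩
    · rw [Finset.card_image_of_injOn, Finset.card_range]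
      intro a ha b hb h
      simp only [Finset.coe_range, Set.mem_Iio] at ha hb
      rcases lt_trichotomy a b with h1 | h1 | h1
      · exact absurd h (hinj a b h1 hb)
      · exact h1
      · exact absurd h.symm (hinj b a h1 ha)
    · intro u hu β
      obtain ⟨j, -, rfl⟩ := Finset.mem_image.1 hu
      obtain ⟨T, hTC, hcard, hT'⟩ := aux_T L k e hL hk he j β
      exact ⟨T, hTC, hcard, fun σ hσ => force j β T hT' σ hσ⟩

open Classical SimpleGraph in
lemma aux_extract {V X : Type*} [Fintype V] [Fintype X] (inc : X → V → Prop)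
    (Maj : (V → Bool) → X → Prop)
    (hT : ∀ σ x a b, Maj σ x → inc x a → inc x b → a ≠ b → σ a = false → σ b = true)
    (hF : ∀ σ x a b, ¬ Maj σ x → inc x a → inc x b → a ≠ b → σ a = true → σ b = false)
    (elt : ∀ x, ∃ v, inc x v) (h3 : ∀ x a b, ∃ c, inc x c ∧ c ≠ a ∧ c ≠ b) (k r : ℕ)
    (hS : ∀ T : Finset X, T.card ≤ 2 * k → ∃ σ, ∀ x, Maj σ x ↔ x ∈ T)
    (hr : Fintype.card V < r ^ k) (H : Finset X) (hH : r * Fintype.card V < H.card) :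
    ∃ C ⊆ H, C.Nonempty ∧ ∃ Q : Finset V, C.card ≤ Q.card ∧ ∀ w ∈ Q, ∀ β, auxF Maj k C w β := by
  obtain ⟨a0, c0, hc0, hl0⟩ := aux_moore inc elt h3 r k hr H hH
  have hex : ∃ l, ∃ (a : V ⊕ X) (c : (auxI inc H).Walk a a), c.IsCycle ∧ c.length = l :=
    ⟨_, a0, c0, hc0, rfl⟩
  obtain ⟨a, c, hc, hl⟩ := Nat.find_spec hex
  have hmin : ∀ a' (c' : (auxI inc H).Walk a' a'), c'.IsCycle → c.length ≤ c'.length := by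
    intro a' c' hc'
    rw [hl]
    exact Nat.find_min' hex ⟨a', c', hc', rfl⟩
  have hleft : ∃ (v0 : V) (p : (auxI inc H).Walk (Sum.inl v0) (Sum.inl v0)),
      p.IsCycle ∧ p.length = c.length := by
    rcases a with v0 | x
    · exact ⟨v0, c, hc, rfl⟩
    · have h3l := hc.three_le_length
      have h1 := c.adj_getVert_succ (i := 0) (by omega)
      rw [c.getVert_zero] at h1
      obtain ⟨v, hv, -⟩ := auxI_r _ _ _ _ h1
      have hm : Sum.inl v ∈ c.support := by
        rw [← hv]; exact c.getVert_mem_support _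
      exact ⟨v, c.rotate _ hm, hc.rotate hm, by simp⟩
  obtain ⟨v0, p, hp, hpl⟩ := hleft
  obtain ⟨L, v, e, hL, hlen, hinc, hv, he⟩ := aux_seq inc H v0 p hp
  have hcl := hmin a0 c0 hc0
  obtain ⟨Q, hQ, hQ2⟩ := aux_core inc Maj hT hF h3 k hS H L v e hL (by omega) hinc hv he
    (by intro a' c' hc'; have := hmin a' c' hc'; omega)
  refine ⟨(Finset.range L).image e, ?_, ?_, Q, ?_, hQ2⟩
  · intro x hx
    obtain ⟨t, -, rfl⟩ := Finset.mem_image.1 hx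
    exact (hinc t).1
  · exact ⟨e 0, Finset.mem_image.2 ⟨0, Finset.mem_range.2 (by omega), rfl⟩⟩
  · exact (Finset.card_image_le.trans (by rw [Finset.card_range])).trans hQ

lemma aux_count {V X : Type*} [Fintype V] [Fintype X] (inc : X → V → Prop)
    (Maj : (V → Bool) → X → Prop)
    (hT : ∀ σ x a b, Maj σ x → inc x a → inc x b → a ≠ b → σ a = false → σ b = true)
    (hF : ∀ σ x a b, ¬ Maj σ x → inc x a → inc x b → a ≠ b → σ a = true → σ b = false)
    (elt : ∀ x, ∃ v, inc x v) (h3 : ∀ x a b, ∃ c, inc x c ∧ c ≠ a ∧ c ≠ b) (k r : ℕ)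
    (hS : ∀ T : Finset X, T.card ≤ 2 * k → ∃ σ, ∀ x, Maj σ x ↔ x ∈ T)
    (hr : Fintype.card V < r ^ k) :
    Fintype.card X ≤ Fintype.card V + r * Fintype.card V := by
  classical
  have key : ∀ H : Finset X, ∃ A : Finset V, H.card ≤ A.card + r * Fintype.card V ∧
      ∀ w ∈ A, ∃ C ⊆ H, ∀ β, auxF Maj k C w β := by
    intro H
    induction H using Finset.strongInduction with
    | H H ih =>
      by_cases hH : r * Fintype.card V < H.card
      · obtain ⟨C, hCH, hCne, Q, hCQ, hQ⟩ :=
          aux_extract inc Maj hT hF elt h3 k r hS hr H hH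
        obtain ⟨A, hA, hA2⟩ := ih (H \ C) (Finset.sdiff_ssubset hCH hCne)
        have hdisj : Disjoint A Q := by
          rw [Finset.disjoint_left]
          intro w hwA hwQ
          obtain ⟨C', hC', hf⟩ := hA2 w hwA
          obtain ⟨T1, hT1, hc1, hf1⟩ := hf true
          obtain ⟨T2, hT2, hc2, hf2⟩ := hQ w hwQ false
          obtain ⟨σ, hσ⟩ := hS (T1 ∪ T2) ((Finset.card_union_le _ _).trans (by omega))
          have hCC : ∀ x ∈ C', x ∉ C := fun x hx => (Finset.mem_sdiff.1 (hC' hx)).2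
          have g1 := hf1 σ (fun x hx => by
            rw [hσ, Finset.mem_union]
            exact ⟨fun h => h.resolve_right (fun h2 => hCC x hx (hT2 h2)), Or.inl⟩)
          have g2 := hf2 σ (fun x hx => by
            rw [hσ, Finset.mem_union]
            exact ⟨fun h => h.resolve_left (fun h2 => hCC x (hT1 h2) hx), Or.inr⟩)
          rw [g1] at g2
          cases g2
        refine ⟨A ∪ Q, ?_, ?_⟩
        · rw [Finset.card_union_of_disjoint hdisj]
          have := Finset.card_sdiff_add_card_eq_card hCH
          omega
        · intro w hw
          rcases Finset.mem_union.1 hw with h | h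
          · obtain ⟨C', hC', hf⟩ := hA2 w h
            exact ⟨C', hC'.trans Finset.sdiff_subset, hf⟩
          · exact ⟨C, hCH, hQ w h⟩
      · exact ⟨∅, by simp; omega, by simp⟩
  obtain ⟨A, hA, -⟩ := key Finset.univ
  rw [Finset.card_univ] at hA
  have := Finset.card_le_univ A
  omega

/-- There exists `m₀` such that for all `m ≥ m₀` and all `n ≥ 4`, every
non-adaptive `(m,n,s,3)`-scheme whose query function is MAJORITY on 3 bits (for
every element) and whose three probe locations are pairwise distinct for each
element, satisfies `s > (1/6)·m^(1 - 1/(⌊n/2⌋+1))`. -/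
theorem majority_three_probe_lower_bound :
    ∃ m₀ : ℕ, ∀ m : ℕ, m₀ ≤ m → ∀ n : ℕ, 4 ≤ n →
    ∀ s : ℕ, ∀ i₁ i₂ i₃ : Fin m → Fin s, ∀ φ : Finset (Fin m) → Fin s → Bool,
      (∀ x : Fin m, i₁ x ≠ i₂ x ∧ i₁ x ≠ i₃ x ∧ i₂ x ≠ i₃ x) →
      (∀ S : Finset (Fin m), S.card ≤ n → ∀ x : Fin m,
        (((φ S (i₁ x) && φ S (i₂ x)) || (φ S (i₁ x) && φ S (i₃ x)) ||
            (φ S (i₂ x) && φ S (i₃ x))) = true ↔ x ∈ S)) →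
      (1 / 6 : ℝ) * (m : ℝ) ^ ((1 : ℝ) - 1 / ((n / 2 + 1 : ℕ) : ℝ)) < (s : ℝ) := by
  refine ⟨1, fun m hm n hn s i₁ i₂ i₃ φ hd hφ => ?_⟩
  by_contra hcon
  rw [not_lt] at hcon
  obtain ⟨k, hk⟩ : ∃ k, k = n / 2 := ⟨_, rfl⟩
  rw [← hk] at hcon
  have hk2 : 2 ≤ k := by omega
  have hs : 1 ≤ s := by
    have := (i₁ ⟨0, hm⟩).isLt
    omega
  -- the bound on `m` from the combinatorial argument
  have hcount : ∀ r, s < r ^ k → m ≤ s + r * s := by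
    intro r hr
    have := aux_count (V := Fin s) (X := Fin m)
      (fun x v => v = i₁ x ∨ v = i₂ x ∨ v = i₃ x)
      (fun σ x => ((σ (i₁ x) && σ (i₂ x)) || (σ (i₁ x) && σ (i₃ x)) ||
            (σ (i₂ x) && σ (i₃ x))) = true) ?_ ?_ ?_ ?_ k r ?_ (by simpa using hr)
    · simpa using this
    · intro σ x a b hM ha hb hab h0
      rcases ha with rfl | rfl | rfl <;> rcases hb with rfl | rfl | rfl <;> simp_all
    · intro σ x a b hM ha hb hab h0
      rcases ha with rfl | rfl | rfl <;> rcases hb with rfl | rfl | rfl <;> simp_all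
    · exact fun x => ⟨_, Or.inl rfl⟩
    · intro x a b
      obtain ⟨h12, h13, h23⟩ := hd x
      by_contra hno
      push Not at hno
      have n1 := hno _ (Or.inl rfl)
      have n2 := hno _ (Or.inr (Or.inl rfl))
      have n3 := hno _ (Or.inr (Or.inr rfl))
      by_cases c1 : i₁ x = a
      · have d2 := n2 (fun h => h12 (c1.trans h.symm))
        have d3 := n3 (fun h => h13 (c1.trans h.symm))
        exact h23 (d2.trans d3.symm)
      · have d1 := n1 c1
        by_cases c2 : i₂ x = a
        · have d3 := n3 (fun h => h23 (c2.trans h.symm))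
          exact h13 (d1.trans d3.symm)
        · exact h12 (d1.trans (n2 c2).symm)
    · intro T hT
      exact ⟨φ T, hφ T (by omega)⟩
  -- choose the least `r` with `s < r ^ k`
  have hex : ∃ r, s < r ^ k := ⟨s + 1, by
    calc s < s + 1 := by omega
      _ ≤ (s + 1) ^ k := Nat.le_self_pow (by omega) _⟩
  obtain ⟨q, hq1, hq2⟩ : ∃ q, s < (q + 1) ^ k ∧ q ^ k ≤ s := by
    rcases h : Nat.find hex with _ | q
    · have := Nat.find_spec hex
      rw [h, zero_pow (by omega)] at this
      omega
    · refine ⟨q, by rw [← h]; exact Nat.find_spec hex, ?_⟩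
      exact not_lt.1 (Nat.find_min hex (by omega))
  have hq0 : 1 ≤ q := by
    rcases Nat.eq_zero_or_pos q with rfl | h
    · simp at hq1; omega
    · exact h
  have hm1 := hcount _ hq1
  have hm2 : m ≤ 3 * q * s := by nlinarith
  have hm3 : m ^ k ≤ 3 ^ k * s ^ (k + 1) := by
    calc m ^ k ≤ (3 * q * s) ^ k := Nat.pow_le_pow_left hm2 k
      _ = 3 ^ k * (q ^ k * s ^ k) := by ring
      _ ≤ 3 ^ k * (s * s ^ k) := by gcongr
      _ = _ := by ring
  have hpow : (6 * s) ^ (k + 1) ≤ m ^ k := by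
    have hm0 : (0 : ℝ) ≤ m := Nat.cast_nonneg m
    have h6 : (6 * s : ℝ) ≤ (m : ℝ) ^ ((1 : ℝ) - 1 / ((k + 1 : ℕ) : ℝ)) := by linarith
    have h7 : (6 * s : ℝ) ^ (k + 1) ≤ ((m : ℝ) ^ ((1 : ℝ) - 1 / ((k + 1 : ℕ) : ℝ))) ^ (k + 1) :=
      pow_le_pow_left₀ (by positivity) h6 _
    rw [← Real.rpow_natCast (_ ^ _), ← Real.rpow_mul hm0] at h7
    have h8 : ((1 : ℝ) - 1 / ((k + 1 : ℕ) : ℝ)) * ((k + 1 : ℕ) : ℝ) = (k : ℝ) := by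
      have : ((k + 1 : ℕ) : ℝ) ≠ 0 := by positivity
      field_simp
      push_cast
      ring
    rw [h8, Real.rpow_natCast] at h7
    exact_mod_cast h7
  have hfin : 3 ^ k * s ^ (k + 1) < (6 * s) ^ (k + 1) := by
    rw [mul_pow]
    apply Nat.mul_lt_mul_of_pos_right _ (by positivity)
    calc 3 ^ k < 3 ^ (k + 1) := Nat.pow_lt_pow_right (by omega) (by omega)
      _ ≤ 6 ^ (k + 1) := Nat.pow_le_pow_left (by omega) _
  omega
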